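/- Let d ≥ 2. For every ε with 0 < ε < 1/2 there exists L > 0 such that for all β, δ > 0 with β - δ > L and every translation invariant, spin-flip symmetric interaction Ψ on Ω = {1,-1}^{Z^d} with ‖Ψ‖ < δ which is zero on non-‖·‖_1-connected sets, writing Φ = Φ^β + Ψ, one has for every finite c-connected Λ ⋐ Z^d and every x ∈ Λ: μ^+_{Φ,Λ}({ω ∈ Ω_Λ : ω(x) = 1}) > 1 - ε and μ^-_{Φ,Λ}({ω ∈ Ω_Λ : ω(x) = -1}) > 1 - ε. -/

import Mathlib

open scoped BigOperators
open Real MeasureTheory Filter Topology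

namespace Ising

/-- The lattice `ℤ^d`. -/
abbrev V (d : ℕ) := Fin d → ℤ
/-- Spin configurations on `ℤ^d`; `true` encodes spin `+1`, `false` encodes spin `-1`. -/
abbrev Config (d : ℕ) := V d → Bool
/-- The ambient euclidean space `ℝ^d`. -/
abbrev Point (d : ℕ) := Fin d → ℝ

variable {d : ℕ}

noncomputable section

/-- The spin value (`±1`) of a boolean. -/
def spin (b : Bool) : ℝ := if b then 1 else -1

/-- An interaction assigns to each finite `Λ ⊆ ℤ^d` a function of configurations
(only the restriction to `Λ` is relevant; see `IsLocal`). -/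
abbrev Interaction (d : ℕ) := Finset (V d) → Config d → ℝ

/-- `Φ_Λ` depends only on the restriction of the configuration to `Λ`. -/
def IsLocal (Φ : Interaction d) : Prop :=
  ∀ (Λ : Finset (V d)) (ω ω' : Config d), (∀ x ∈ Λ, ω x = ω' x) → Φ Λ ω = Φ Λ ω'

/-- Translation of a configuration: `(τ^a ω)(x) = ω(x+a)`. -/
def translate (a : V d) (ω : Config d) : Config d := fun x => ω (x + a)

/-- Translation invariance of an interaction: `Φ_Λ(ω) = Φ_{Λ-a}(τ^a ω)`. -/
def TransInv (Φ : Interaction d) : Prop :=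
  ∀ (a : V d) (Λ : Finset (V d)) (ω : Config d),
    Φ (Λ.image (fun x => x - a)) (translate a ω) = Φ Λ ω

/-- Spin-flip symmetry: `Ψ_Λ(ω) = Ψ_Λ(-ω)`. -/
def SpinFlipSymm (Ψ : Interaction d) : Prop :=
  ∀ (Λ : Finset (V d)) (ω : Config d), Ψ Λ (fun x => !(ω x)) = Ψ Λ ω

/-- `sup_{ω ∈ Ω_Λ} |Φ_Λ(ω)|`. -/
def supNorm (Φ : Interaction d) (Λ : Finset (V d)) : ℝ := ⨆ ω : Config d, |Φ Λ ω|

/-- The summand of the norm `‖Φ‖`. -/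
def normTerm (Φ : Interaction d) (Λ : Finset (V d)) : ℝ :=
  if (0 : V d) ∈ Λ then supNorm Φ Λ else 0

/-- `‖Φ‖ = Σ_{0 ∈ Λ ⋐ ℤ^d} sup_{ω} |Φ_Λ(ω)|`. -/
def anorm (Φ : Interaction d) : ℝ := ∑' Λ : Finset (V d), normTerm Φ Λ

/-- Absolute summability of an interaction. -/
def AbsSummable (Φ : Interaction d) : Prop := Summable (normTerm Φ)

/-- `‖x-y‖_∞`. -/
def distInf (x y : V d) : ℕ := Finset.univ.sup fun i => (x i - y i).natAbs

/-- `‖x-y‖_1`. -/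
def dist1 (x y : V d) : ℕ := ∑ i, (x i - y i).natAbs

/-- `diam(Λ) = sup {‖x-y‖_∞ : x, y ∈ Λ}`. -/
def diam (Λ : Finset (V d)) : ℕ := Λ.sup fun x => Λ.sup fun y => distInf x y

/-- The summand of the `d`-th order decaying norm `|||Ψ|||`. -/
def dTerm (Ψ : Interaction d) (Λ : Finset (V d)) : ℝ :=
  if (0 : V d) ∈ Λ then ((diam Λ + 1 : ℕ) : ℝ) ^ d * supNorm Ψ Λ else 0

/-- `|||Ψ||| = Σ_{0 ∈ Λ ⋐ ℤ^d} (diam(Λ)+1)^d sup_{ω} |Ψ_Λ(ω)|`. -/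
def dnorm (Ψ : Interaction d) : ℝ := ∑' Λ : Finset (V d), dTerm Ψ Λ

/-- Summability of the `d`-th order decaying norm. -/
def DSummable (Ψ : Interaction d) : Prop := Summable (dTerm Ψ)

/-- The summand of the norm `|||Ψ|||'`. -/
def dTerm' (Ψ : Interaction d) (Λ : Finset (V d)) : ℝ :=
  if (0 : V d) ∈ Λ then (Λ.card : ℝ)⁻¹ * ((diam Λ + 1 : ℕ) : ℝ) ^ d * supNorm Ψ Λ else 0

/-- `|||Ψ|||' = Σ_{0 ∈ Λ ⋐ ℤ^d} |Λ|⁻¹ (diam(Λ)+1)^d sup_{ω} |Ψ_Λ(ω)|`. -/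
def dnorm' (Ψ : Interaction d) : ℝ := ∑' Λ : Finset (V d), dTerm' Ψ Λ

/-- Summability of the norm `|||·|||'`. -/
def DSummable' (Ψ : Interaction d) : Prop := Summable (dTerm' Ψ)

/-- The Hamiltonian `H_{Φ,Λ}(ω) = Σ_{Δ ⋐ ℤ^d, Δ ∩ Λ ≠ ∅} Φ_Δ(ω|_Δ)`. -/
def ham (Φ : Interaction d) (Λ : Finset (V d)) (ω : Config d) : ℝ :=
  ∑' Δ : Finset (V d), if (Δ ∩ Λ).Nonempty then Φ Δ ω else 0

/-- The configuration `ω_Λ ∨ η` agreeing with `f` on `Λ` and with `η` off `Λ`. -/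
def fill (Λ : Finset (V d)) (f : ↥Λ → Bool) (η : Config d) : Config d :=
  fun x => if h : x ∈ Λ then f ⟨x, h⟩ else η x

/-- The partition function `Z^η_{Φ,Λ}`. -/
def gibbsZ (Φ : Interaction d) (Λ : Finset (V d)) (η : Config d) : ℝ :=
  ∑ f : ↥Λ → Bool, Real.exp (-(ham Φ Λ (fill Λ f η)))

/-- The finite Gibbs state `μ^η_{Φ,Λ}({ω_Λ})`. -/
def finGibbs (Φ : Interaction d) (Λ : Finset (V d)) (η : Config d) (f : ↥Λ → Bool) : ℝ :=
  Real.exp (-(ham Φ Λ (fill Λ f η))) / gibbsZ Φ Λ η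

/-- The cylinder set `{ξ : ξ|_Λ = f}`. -/
def cyl (Λ : Finset (V d)) (f : ↥Λ → Bool) : Set (Config d) :=
  {ξ | ∀ (x : V d) (h : x ∈ Λ), ξ x = f ⟨x, h⟩}

/-- `σ` is a Gibbs state for `Φ` (DLR condition): for each finite `Λ` there is a Borel
probability measure on boundary conditions with respect to which `σ` of each cylinder
is the average of the finite Gibbs states. -/
def IsGibbs (Φ : Interaction d) (σ : Measure (Config d)) : Prop :=
  IsProbabilityMeasure σ ∧
  ∀ Λ : Finset (V d), ∃ ν : Measure (Config d), IsProbabilityMeasure ν ∧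
    ∀ f : ↥Λ → Bool, (σ (cyl Λ f)).toReal = ∫ η, finGibbs Φ Λ η f ∂ν

/-- Translation invariance of a measure: `τ^a_* σ = σ`. -/
def MeasTransInv (σ : Measure (Config d)) : Prop :=
  ∀ a : V d, σ.map (translate a) = σ

/-- The Ising interaction at inverse temperature `β`:
`Φ^β_Λ(ω) = -β ω(x) ω(y)` if `Λ = {x,y}` with `‖x-y‖₁ = 1`, and `0` otherwise. -/
def ising (β : ℝ) : Interaction d := fun Λ ω =>
  if Λ.card = 2 ∧ ∀ x ∈ Λ, ∀ y ∈ Λ, x ≠ y → dist1 x y = 1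
  then -β * ∏ x ∈ Λ, spin (ω x) else 0

/-- The sum of two interactions. -/
def Iadd (Φ Ψ : Interaction d) : Interaction d := fun Λ ω => Φ Λ ω + Ψ Λ ω

/-- `S` is connected for the adjacency given by `ρ`-distance `1`. -/
def ConnectedBy (ρ : V d → V d → ℕ) (S : Set (V d)) : Prop :=
  ∀ x ∈ S, ∀ y ∈ S, ∃ (n : ℕ) (p : ℕ → V d), p 0 = x ∧ p n = y ∧
    (∀ i ≤ n, p i ∈ S) ∧ ∀ i < n, ρ (p i) (p (i+1)) = 1

/-- `‖·‖₁`-connectedness. -/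
def Conn1 (S : Set (V d)) : Prop := ConnectedBy dist1 S

/-- `‖·‖_∞`-connectedness. -/
def ConnInf (S : Set (V d)) : Prop := ConnectedBy distInf S

/-- A finite set `Λ` is c-connected if both `Λ` and its complement are `‖·‖_∞`-connected. -/
def CConn (Λ : Finset (V d)) : Prop :=
  ConnInf (↑Λ : Set (V d)) ∧ ConnInf ((↑Λ : Set (V d))ᶜ)

/-- `Ψ` vanishes on sets that are not `‖·‖₁`-connected. -/
def ZeroOnNonConn (Ψ : Interaction d) : Prop :=
  ∀ Λ : Finset (V d), ¬ Conn1 (↑Λ : Set (V d)) → ∀ ω, Ψ Λ ω = 0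

/-- The closed unit cube `I_x` centered at `x ∈ ℤ^d`. -/
def cube (x : V d) : Set (Point d) := {y | ∀ i, |y i - (x i : ℝ)| ≤ 1/2}

/-- `M(S) = ⋃_{x ∈ S} I_x`. -/
def cubes (S : Set (V d)) : Set (Point d) := ⋃ x ∈ S, cube x

/-- A contour is the boundary `∂M(S)` of `M(S)` for a finite c-connected `S`. -/
def IsContour (γ : Set (Point d)) : Prop :=
  ∃ S : Finset (V d), CConn S ∧ γ = frontier (cubes ↑S)

/-- The set of sites with spin `-1`. -/
def minusSet (ω : Config d) : Set (V d) := {x | ω x = false}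

/-- `Γ(ω)`: the connected components of `∂M({x : ω(x) = -1})`. -/
def Gamma (ω : Config d) : Set (Set (Point d)) :=
  {γ | ∃ y ∈ frontier (cubes (minusSet ω)),
    γ = connectedComponentIn (frontier (cubes (minusSet ω))) y}

/-- The `(d-1)`-dimensional face of the unit cubes lying between `x` and `x + e_i`. -/
def face (x : V d) (i : Fin d) : Set (Point d) :=
  {y | y i = (x i : ℝ) + 1/2 ∧ ∀ j, j ≠ i → |y j - (x j : ℝ)| ≤ 1/2}

/-- A plaquette is a `(d-1)`-dimensional face of one of the cubes `I_x`. -/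
def IsPlaquette (P : Set (Point d)) : Prop := ∃ x i, P = face x i

/-- `|γ|`: the number of plaquettes contained in `γ`. -/
def csize (γ : Set (Point d)) : ℕ :=
  Nat.card {P : Set (Point d) // IsPlaquette P ∧ P ⊆ γ}

/-- The constant `+1` configuration. -/
def plusC : Config d := fun _ => true

/-- The constant `-1` configuration. -/
def minusC : Config d := fun _ => false

open scoped Classical in
/-- The finite-volume Gibbs probability (with boundary condition `η`) of an event
`A`: `μ^η_{Φ,Λ}({ω : ω ∨ η ∈ A})`. -/
def bcProb (Φ : Interaction d) (Λ : Finset (V d)) (η : Config d) (A : Set (Config d)) : ℝ :=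
  (∑ f : ↥Λ → Bool, if fill Λ f η ∈ A then Real.exp (-(ham Φ Λ (fill Λ f η))) else 0) /
    gibbsZ Φ Λ η

/-- `ω ∈ Ω_Λ^+`, i.e. `ω` is `+1` off `Λ`. -/
def plusOutside (Λ : Finset (V d)) (ω : Config d) : Prop := ∀ x, x ∉ Λ → ω x = true

/-- The configuration obtained by flipping all spins in `S`. -/
def flipOn (S : Finset (V d)) (ω : Config d) : Config d :=
  fun x => if x ∈ S then !(ω x) else ω x

/-- `|𝓔_Λ|`: the number of nearest-neighbour edges meeting `Λ`. -/
def edgeCount (Λ : Finset (V d)) : ℕ :=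
  Nat.card {e : Finset (V d) // (∃ x y, e = {x, y} ∧ dist1 x y = 1) ∧ (e ∩ Λ).Nonempty}

/-- `R` is a (nonempty) rectangle in `ℤ^d`. -/
def IsRect (R : Finset (V d)) : Prop := ∃ a b : V d, a ≤ b ∧ R = Finset.Icc a b

/-- `R(Λ)`: the minimal rectangle containing `Λ`. -/
def minRect (Λ : Finset (V d)) : Finset (V d) :=
  if h : Λ.Nonempty then
    Finset.Icc (fun i => Λ.inf' h fun x => x i) (fun i => Λ.sup' h fun x => x i)
  else ∅

open scoped Classical in
/-- The rectangle regrouping `Ψ̃` of `Ψ`: `Ψ̃_R(ω) = Σ_{Λ : R(Λ) = R} Ψ_Λ(ω|_Λ)` for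
rectangles `R`, and `Ψ̃_Λ = 0` for non-rectangles. -/
def regroup (Ψ : Interaction d) : Interaction d := fun R ω =>
  if IsRect R then ∑ Λ ∈ R.powerset, (if minRect Λ = R then Ψ Λ ω else 0) else 0


/-- `‖a-b‖_∞ ≤ 1`. -/
def near (a b : V d) : Prop := ∀ i, |a i - b i| ≤ 1

lemma near_refl (a : V d) : near a a := by intro i; simp

lemma near_symm {a b : V d} (h : near a b) : near b a := by
  intro i; rw [abs_sub_comm]; exact h i

lemma near_of_distInf {a b : V d} (h : distInf a b = 1) : near a b := by
  intro i
  have : (a i - b i).natAbs ≤ distInf a b := by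
    unfold distInf
    exact Finset.le_sup (f := fun i => (a i - b i).natAbs) (Finset.mem_univ i)
  rw [h] at this
  rw [abs_le]; omega

/-- Connection inside `A` by `near` steps. -/
def conn (A : Set (V d)) (a b : V d) : Prop :=
  Relation.ReflTransGen (fun a b => near a b ∧ a ∈ A ∧ b ∈ A) a b

lemma conn_of_connInf {A : Set (V d)} (h : ConnInf A) {x y : V d} (hx : x ∈ A) (hy : y ∈ A) :
    conn A x y := by
  obtain ⟨n, p, h0, hn, hA, hs⟩ := h x hx y hy
  have key : ∀ k ≤ n, conn A (p 0) (p k) := by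
    intro k
    induction k with
    | zero => intro _; exact Relation.ReflTransGen.refl
    | succ k ih =>
      intro hk
      exact (ih (by omega)).tail
        ⟨near_of_distInf (hs k (by omega)), hA k (by omega), hA (k+1) hk⟩
  have := key n le_rfl
  rwa [h0, hn] at this

lemma conn_symm {A : Set (V d)} {a b : V d} (h : conn A a b) : conn A b a := by
  induction h with
  | refl => exact Relation.ReflTransGen.refl
  | tail _ h2 ih =>
    exact Relation.ReflTransGen.head ⟨near_symm h2.1, h2.2.2, h2.2.1⟩ ih

/-! ### A discrete Poincare lemma -/

/-- Clamp all coordinates into `[-n, n]`. -/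
def clampBox (n : ℕ) (x : V d) : V d := fun i => max (-(n:ℤ)) (min n (x i))

/-- The box of radius `n`. -/
def inBox (n : ℕ) (x : V d) : Prop := ∀ i, -(n:ℤ) ≤ x i ∧ x i ≤ n

/-- A potential for a closed cochain. -/
def pot (c : V d → V d → Bool) : ℕ → V d → Bool
  | 0, _ => false
  | n+1, x => xor (pot c n (clampBox n x)) (c (clampBox n x) x)

lemma clamp_inBox (n : ℕ) (x : V d) : inBox n (clampBox n x) := by
  intro i; simp only [clampBox]; omega

lemma clamp_of_inBox {n : ℕ} {x : V d} (h : inBox n x) : clampBox n x = x := by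
  funext i; have := h i; simp only [clampBox]; omega

lemma near_clamp {n : ℕ} {x y : V d} (hx : inBox (n+1) x) (hy : inBox (n+1) y)
    (h : near x y) : near x (clampBox n y) := by
  intro i
  have h1 := hx i
  have h2 := hy i
  have h3 := h i
  simp only [clampBox]
  rw [abs_le] at *
  push_cast at *
  omega

lemma near_clamp_clamp {n : ℕ} {x y : V d} 
    (h : near x y) : near (clampBox n x) (clampBox n y) := by
  intro i
  have h3 := h i
  simp only [clampBox]
  rw [abs_le] at *
  omega

lemma pot_spec (c : V d → V d → Bool)
    (hc : ∀ x y z, near x y → near y z → near x z → c x z = xor (c x y) (c y z)) (n : ℕ) :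
    ∀ x y, inBox n x → inBox n y → near x y → c x y = xor (pot c n x) (pot c n y) := by
  have hself : ∀ x, c x x = false := by
    intro x
    have := hc x x x (near_refl _) (near_refl _) (near_refl _)
    simpa using this
  have hsym : ∀ x y, near x y → c x y = c y x := by
    intro x y h
    have := hc x y x h (near_symm h) (near_refl _)
    rw [hself] at this
    revert this
    cases c x y <;> cases c y x <;> simp
  induction n with
  | zero =>
    intro x y hx hy _
    have : x = y := by
      funext i; have := hx i; have := hy i; push_cast at *; omega
    subst this
    simp [hself]
  | succ n ih =>
    intro x y hx hy h
    have e1 := ih _ _ (clamp_inBox n x) (clamp_inBox n y) (near_clamp_clamp h)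
    have n1 : near x (clampBox n x) := near_clamp hx hx (near_refl x)
    have n2 : near y (clampBox n y) := near_clamp hy hy (near_refl y)
    have n3 : near x (clampBox n y) := near_clamp hx hy h
    have e2 := hc x (clampBox n y) y n3 (near_symm n2) h
    have e3 := hc x (clampBox n x) (clampBox n y) n1 (near_clamp_clamp h) n3
    have e4 := hsym _ _ n1
    simp only [pot]
    rw [e2, e3, e1, e4]
    cases c (clampBox n x) x <;> cases c (clampBox n y) y <;> cases pot c n (clampBox n x) <;>
      cases pot c n (clampBox n y) <;> rfl

lemma pot_stable (c : V d → V d → Bool) (hself : ∀ x, c x x = false) {n m : ℕ} (h : n ≤ m) :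
    ∀ x, inBox n x → pot c m x = pot c n x := by
  induction m, h using Nat.le_induction with
  | base => intro x _; rfl
  | succ m hm ih =>
    intro x hx
    have hx' : inBox m x := by
      intro i; have := hx i; omega
    simp only [pot, clamp_of_inBox hx', hself, ih x hx, Bool.xor_false]

lemma exists_inBox (x : V d) : ∃ n, inBox n x := by
  refine ⟨Finset.univ.sup fun i => (x i).natAbs, fun i => ?_⟩
  have : (x i).natAbs ≤ Finset.univ.sup fun i => (x i).natAbs :=
    Finset.le_sup (f := fun i => (x i).natAbs) (Finset.mem_univ i)
  omega

lemma poincare (c : V d → V d → Bool)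
    (hc : ∀ x y z, near x y → near y z → near x z → c x z = xor (c x y) (c y z)) :
    ∃ f : V d → Bool, ∀ x y, near x y → c x y = xor (f x) (f y) := by
  have hself : ∀ x, c x x = false := by
    intro x
    have := hc x x x (near_refl _) (near_refl _) (near_refl _)
    simpa using this
  choose N hN using (exists_inBox (d := d))
  refine ⟨fun x => pot c (N x) x, fun x y h => ?_⟩
  have hx : inBox (max (N x) (N y)) x := by
    intro i; have := hN x i; have := le_max_left (N x) (N y); omega
  have hy : inBox (max (N x) (N y)) y := by
    intro i; have := hN y i; have := le_max_right (N x) (N y); omega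
  rw [pot_spec c hc _ x y hx hy h, pot_stable c hself (le_max_left _ _) x (hN x),
    pot_stable c hself (le_max_right _ _) y (hN y)]

open scoped Classical in
/-- Inner boundary of `S`. -/
def inner (S : Finset (V d)) : Finset (V d) := S.filter fun y => ∃ z, z ∉ S ∧ near y z

lemma mem_inner {S : Finset (V d)} {y : V d} :
    y ∈ inner S ↔ y ∈ S ∧ ∃ z, z ∉ S ∧ near y z := by
  simp [inner]

/-- `S` and its complement are connected. -/
def biconn (S : Finset (V d)) : Prop :=
  (∀ a ∈ S, ∀ b ∈ S, conn (↑S : Set (V d)) a b) ∧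
  (∀ a, a ∉ S → ∀ b, b ∉ S → conn ((↑S : Set (V d))ᶜ) a b)

open scoped Classical in
lemma inner_connected {S : Finset (V d)} (hS : biconn S) (T1 : Finset (V d))
    (hT1 : T1 ⊆ inner S) (hne : T1.Nonempty)
    (hcl : ∀ a ∈ T1, ∀ b ∈ inner S, near a b → b ∈ T1) : inner S = T1 := by
  let c : V d → V d → Bool := fun x y => decide ((x ∈ T1 ∧ y ∉ S) ∨ (y ∈ T1 ∧ x ∉ S))
  have hTS : ∀ a ∈ T1, a ∈ S := fun a ha => (mem_inner.1 (hT1 ha)).1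
  have hiff : ∀ a b z, a ∈ S → b ∈ S → z ∉ S → near a b → near a z → near b z →
      (a ∈ T1 ↔ b ∈ T1) := by
    intro a b z ha hb hz h1 h2 h3
    exact ⟨fun h => hcl a h b (mem_inner.2 ⟨hb, z, hz, h3⟩) h1,
      fun h => hcl b h a (mem_inner.2 ⟨ha, z, hz, h2⟩) (near_symm h1)⟩
  obtain ⟨f, hf⟩ := poincare c (by
    intro x y z hxy hyz hxz
    have hx := hTS x
    have hy := hTS y
    have hz := hTS z
    have a1 : x ∈ S → y ∈ S → z ∉ S → (x ∈ T1 ↔ y ∈ T1) :=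
      fun h1 h2 h3 => hiff x y z h1 h2 h3 hxy hxz hyz
    have a2 : x ∈ S → z ∈ S → y ∉ S → (x ∈ T1 ↔ z ∈ T1) :=
      fun h1 h2 h3 => hiff x z y h1 h2 h3 hxz hxy (near_symm hyz)
    have a3 : y ∈ S → z ∈ S → x ∉ S → (y ∈ T1 ↔ z ∈ T1) :=
      fun h1 h2 h3 => hiff y z x h1 h2 h3 hyz (near_symm hxy) (near_symm hxz)
    simp only [c]
    clear hiff hcl hTS hT1
    by_cases b1 : x ∈ S <;> by_cases b2 : y ∈ S <;> by_cases b3 : z ∈ S <;>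
    by_cases b4 : x ∈ T1 <;> by_cases b5 : y ∈ T1 <;> by_cases b6 : z ∈ T1 <;>
    simp_all)
  have hfS : ∀ a b, conn (↑S : Set (V d)) a b → f a = f b := by
    intro a b h
    induction h with
    | refl => rfl
    | tail _ h2 ih =>
      rw [ih]
      obtain ⟨h3, h4, h5⟩ := h2
      have := hf _ _ h3
      simp only [Finset.mem_coe] at h4 h5
      simp only [c, h4, h5, not_true, and_false, or_false, decide_false] at this
      simpa using this.symm
  have hfU : ∀ a b, conn ((↑S : Set (V d))ᶜ) a b → f a = f b := by
    intro a b h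
    induction h with
    | refl => rfl
    | tail _ h2 ih =>
      rw [ih]
      obtain ⟨h3, h4, h5⟩ := h2
      have := hf _ _ h3
      simp only [Set.mem_compl_iff, Finset.mem_coe] at h4 h5
      have h4' := mt (hTS _) h4
      have h5' := mt (hTS _) h5
      simp only [c, h4', h5', false_and, or_false, decide_false] at this
      simpa using this.symm
  obtain ⟨t1, ht1⟩ := hne
  obtain ⟨hs1, z1, hz1, hn1⟩ := mem_inner.1 (hT1 ht1)
  refine Finset.Subset.antisymm ?_ hT1
  intro t ht
  obtain ⟨hs, z, hz, hn⟩ := mem_inner.1 ht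
  have e1 := hfS t t1 (hS.1 _ hs _ hs1)
  have e2 := hfU z z1 (hS.2 _ hz _ hz1)
  have e3 := hf _ _ hn1
  have e4 := hf _ _ hn
  rw [e1, e2, ← e3] at e4
  have hzT : z ∉ T1 := fun h => hz (hTS _ h)
  have hzT1 : z1 ∉ T1 := fun h => hz1 (hTS _ h)
  simpa [c, ht1, hz1, hz, hzT] using e4

/-- `S` is determined by its inner boundary. -/
lemma inner_inj_aux {S S' : Finset (V d)} (hS : biconn S) (p : V d) (hp : p ∉ S) (hp' : p ∉ S')
    (h : inner S = inner S') : S' ⊆ S := by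
  have key : ∀ u, conn ((↑S : Set (V d))ᶜ) p u → u ∉ S' := by
    intro u hu
    induction hu with
    | refl => exact hp'
    | @tail b c _ h2 ih =>
      obtain ⟨h3, h4, h5⟩ := h2
      intro hc
      have : c ∈ inner S' := mem_inner.2 ⟨hc, b, ih, near_symm h3⟩
      rw [← h] at this
      exact h5 (mem_inner.1 this).1
  intro u hu
  by_contra hu'
  exact key u (hS.2 p hp u hu') hu

lemma inner_inj {S S' : Finset (V d)} (hS : biconn S) (hS' : biconn S') (p : V d)
    (hp : p ∉ S) (hp' : p ∉ S') (h : inner S = inner S') : S = S' :=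
  Finset.Subset.antisymm (inner_inj_aux hS' p hp' hp h.symm) (inner_inj_aux hS p hp hp' h)

/-! ### Encoding connected sets by walks -/

/-- Unit displacements (including zero). -/
def moves (d : ℕ) : Finset (V d) := Finset.Icc (fun _ => (-1:ℤ)) (fun _ => 1)

lemma mem_moves {m : V d} : m ∈ moves d ↔ ∀ i, |m i| ≤ 1 := by
  simp only [moves, Finset.mem_Icc, Pi.le_def, abs_le]
  exact ⟨fun h i => ⟨h.1 i, h.2 i⟩, fun h => ⟨fun i => (h i).1, fun i => (h i).2⟩⟩

/-- The set visited by a walk. -/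
def visited : V d → List (V d) → Finset (V d)
  | v, [] => {v}
  | v, m :: w => insert v (visited (v + m) w)

lemma start_mem_visited (v : V d) (w : List (V d)) : v ∈ visited v w := by
  cases w <;> simp [visited]

lemma detour (m : V d) (hm : m ∈ moves d) (w : List (V d)) : ∀ (v b : V d), b ∈ visited v w →
    (∀ a ∈ w, a ∈ moves d) →
    ∃ w' : List (V d), w'.length = w.length + 2 ∧ (∀ a ∈ w', a ∈ moves d) ∧
      visited v w' = insert (b + m) (visited v w) := by
  have hm' : -m ∈ moves d := by
    rw [mem_moves] at *; intro i; simpa using hm i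
  have base : ∀ (v : V d) (w : List (V d)), (∀ a ∈ w, a ∈ moves d) →
      ∃ w' : List (V d), w'.length = w.length + 2 ∧ (∀ a ∈ w', a ∈ moves d) ∧
      visited v w' = insert (v + m) (visited v w) := by
    intro v w hw
    refine ⟨m :: (-m) :: w, by simp, ?_, ?_⟩
    · intro a ha
      simp only [List.mem_cons] at ha
      rcases ha with rfl | rfl | ha
      exacts [hm, hm', hw a ha]
    · simp only [visited, add_neg_cancel_right]
      rw [Finset.insert_comm, Finset.insert_eq_of_mem (start_mem_visited v w)]
  induction w with
  | nil =>
    intro v b hb hw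
    simp only [visited, Finset.mem_singleton] at hb
    subst hb
    exact base b [] hw
  | cons k w ih =>
    intro v b hb hw
    simp only [visited, Finset.mem_insert] at hb
    rcases hb with rfl | hb
    · exact base b _ hw
    · obtain ⟨w', h1, h2, h3⟩ := ih (v + k) b hb (fun a ha => hw a (List.mem_cons_of_mem _ ha))
      refine ⟨k :: w', by simp [h1], ?_, ?_⟩
      · intro a ha
        simp only [List.mem_cons] at ha
        rcases ha with rfl | ha
        exacts [hw _ List.mem_cons_self, h2 a ha]
      · simp only [visited, h3]
        rw [Finset.insert_comm]

lemma exists_walk (T : Finset (V d)) (v : V d) (hv : v ∈ T)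
    (hT : ∀ B ⊆ T, B.Nonempty → (∀ a ∈ B, ∀ b ∈ T, near a b → b ∈ B) → T = B)
    (t : ℕ) (ht : T.card ≤ t) :
    ∃ w : List (V d), w.length = 2 * t ∧ (∀ a ∈ w, a ∈ moves d) ∧ visited v w = T := by
  have key : ∀ k, ∃ w : List (V d), w.length = 2 * k ∧ (∀ a ∈ w, a ∈ moves d) ∧
      visited v w ⊆ T ∧ (visited v w = T ∨ k < (visited v w).card) := by
    intro k
    induction k with
    | zero => exact ⟨[], by simp, by simp, by simpa [visited] using hv, by simp [visited]⟩
    | succ k ih =>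
      obtain ⟨w, h1, h2, h3, h4⟩ := ih
      by_cases h : visited v w = T
      · obtain ⟨w', a1, a2, a3⟩ := detour 0 (by rw [mem_moves]; simp) w v v
          (start_mem_visited v w) h2
        rw [add_zero, Finset.insert_eq_of_mem (start_mem_visited v w)] at a3
        exact ⟨w', by omega, a2, a3 ▸ h3, Or.inl (a3.trans h)⟩
      · have : ∃ a ∈ visited v w, ∃ b ∈ T, near a b ∧ b ∉ visited v w := by
          by_contra hcon
          push Not at hcon
          exact h (hT _ h3 ⟨v, start_mem_visited v w⟩ hcon).symm
        obtain ⟨a, ha, b, hb, hab, hbn⟩ := this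
        obtain ⟨w', a1, a2, a3⟩ := detour (b - a) (by
          rw [mem_moves]; intro i; exact near_symm hab i) w v a ha h2
        rw [add_sub_cancel] at a3
        refine ⟨w', by omega, a2, ?_, Or.inr ?_⟩
        · rw [a3]; exact Finset.insert_subset hb h3
        · rw [a3, Finset.card_insert_of_notMem hbn]
          rcases h4 with h4 | h4
          · exact absurd h4 h
          · omega
  obtain ⟨w, h1, h2, h3, h4⟩ := key t
  refine ⟨w, h1, h2, ?_⟩
  rcases h4 with h4 | h4
  · exact h4
  · have := Finset.card_le_card h3
    omega

/-! ### Boundary edges -/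

/-- Nearest neighbour edges. -/
def isEdge (Δ : Finset (V d)) : Prop :=
  Δ.card = 2 ∧ ∀ x ∈ Δ, ∀ y ∈ Δ, x ≠ y → dist1 x y = 1

lemma near_of_dist1 {a b : V d} (h : dist1 a b = 1) : near a b := by
  intro i
  have : (a i - b i).natAbs ≤ dist1 a b := by
    unfold dist1
    exact Finset.single_le_sum (f := fun i => (a i - b i).natAbs) (fun _ _ => Nat.zero_le _)
      (Finset.mem_univ i)
  rw [h] at this
  rw [abs_le]; omega

lemma dist1_comm (a b : V d) : dist1 a b = dist1 b a := by
  unfold dist1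
  refine Finset.sum_congr rfl fun i _ => ?_
  omega

lemma dist1_self (a : V d) : dist1 a a = 0 := by simp [dist1]

open scoped Classical in
/-- Edges joining `S` and its complement. -/
def CE (S : Finset (V d)) : Finset (Finset (V d)) :=
  ((S ×ˢ moves d).image fun q => {q.1, q.1 + q.2}).filter
    fun Δ => isEdge Δ ∧ (∃ y ∈ Δ, y ∈ S) ∧ ∃ z ∈ Δ, z ∉ S

lemma mem_CE {S Δ : Finset (V d)} :
    Δ ∈ CE S ↔ isEdge Δ ∧ (∃ y ∈ Δ, y ∈ S) ∧ ∃ z ∈ Δ, z ∉ S := by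
  classical
  simp only [CE, Finset.mem_filter, and_iff_right_iff_imp]
  rintro ⟨hE, ⟨y, hy, hyS⟩, z, hz, hzS⟩
  have hyz : y ≠ z := by rintro rfl; exact hzS hyS
  refine Finset.mem_image.2 ⟨(y, z - y), Finset.mem_product.2 ⟨hyS, ?_⟩, ?_⟩
  · rw [mem_moves]
    intro i
    exact near_symm (near_of_dist1 (hE.2 y hy z hz hyz)) i
  · simp only [add_sub_cancel]
    refine Finset.eq_of_subset_of_card_le ?_ ?_
    · intro a ha
      simp only [Finset.mem_insert, Finset.mem_singleton] at ha
      rcases ha with rfl | rfl <;> assumption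
    · rw [hE.1, Finset.card_pair hyz]

lemma pair_mem_CE {S : Finset (V d)} {y z : V d} (hy : y ∈ S) (hz : z ∉ S)
    (h : dist1 y z = 1) : ({y, z} : Finset (V d)) ∈ CE S := by
  have hyz : y ≠ z := by rintro rfl; exact hz hy
  refine mem_CE.2 ⟨⟨Finset.card_pair hyz, ?_⟩, ⟨y, by simp, hy⟩, z, by simp, hz⟩
  intro a ha b hb hab
  simp only [Finset.mem_insert, Finset.mem_singleton] at ha hb
  rcases ha with rfl | rfl <;> rcases hb with rfl | rfl
  · exact absurd rfl hab
  · exact h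
  · rw [dist1_comm]; exact h
  · exact absurd rfl hab

lemma inner_near_edge {S : Finset (V d)} {y : V d} (hy : y ∈ inner S) :
    ∃ Δ ∈ CE S, ∃ v ∈ Δ, near v y := by
  obtain ⟨hyS, z, hz, hn⟩ := mem_inner.1 hy
  let w : ℕ → V d := fun k j => if (j : ℕ) < k then z j else y j
  have hw0 : w 0 = y := by funext j; simp [w]
  have hwd : w d = z := by funext j; simp [w]
  have : ∃ k < d, w k ∈ S ∧ w (k+1) ∉ S := by
    by_contra hcon
    push Not at hcon
    have : ∀ k ≤ d, w k ∈ S := by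
      intro k
      induction k with
      | zero => intro _; rw [hw0]; exact hyS
      | succ k ih => intro hk; exact hcon k (by omega) (ih (by omega))
    exact hz (hwd ▸ this d le_rfl)
  obtain ⟨k, hk, h1, h2⟩ := this
  have hle : dist1 (w k) (w (k+1)) = (y ⟨k, hk⟩ - z ⟨k, hk⟩).natAbs := by
    unfold dist1
    rw [Finset.sum_eq_single (⟨k, hk⟩ : Fin d)]
    · simp [w]
    · intro j _ hj
      have : (j : ℕ) ≠ k := fun h => hj (Fin.ext h)
      by_cases h3 : (j : ℕ) < k
      · simp [w, h3, show (j:ℕ) < k + 1 by omega]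
      · simp [w, h3, show ¬ (j:ℕ) < k + 1 by omega]
    · simp
  have hne : y ⟨k, hk⟩ ≠ z ⟨k, hk⟩ := by
    intro h
    apply h2
    have : w (k+1) = w k := by
      funext j
      by_cases h3 : (j : ℕ) < k
      · simp [w, h3, show (j:ℕ) < k + 1 by omega]
      · by_cases h4 : (j : ℕ) = k
        · have : j = ⟨k, hk⟩ := Fin.ext h4
          subst this
          simp [w, h]
        · simp [w, h3, show ¬ (j:ℕ) < k + 1 by omega]
    rwa [this]
  have hd1 : dist1 (w k) (w (k+1)) = 1 := by
    rw [hle]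
    have := hn ⟨k, hk⟩
    rw [abs_le] at this
    omega
  refine ⟨_, pair_mem_CE h1 h2 hd1, w k, by simp, ?_⟩
  intro j
  by_cases h3 : (j : ℕ) < k
  · simpa [w, h3] using near_symm hn j
  · simp [w, h3]

lemma card_inner_le (S : Finset (V d)) :
    (inner S).card ≤ 2 * (moves d).card * (CE S).card := by
  classical
  have hsub : inner S ⊆ (CE S).biUnion fun Δ => Δ.biUnion fun v => (moves d).image fun m => v + m := by
    intro y hy
    obtain ⟨Δ, hΔ, v, hv, hn⟩ := inner_near_edge hy
    refine Finset.mem_biUnion.2 ⟨Δ, hΔ, Finset.mem_biUnion.2 ⟨v, hv, Finset.mem_image.2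
      ⟨y - v, ?_, by simp⟩⟩⟩
    rw [mem_moves]
    exact fun i => near_symm hn i
  refine (Finset.card_le_card hsub).trans ?_
  rw [mul_comm]
  refine Finset.card_biUnion_le_card_mul _ _ _ fun Δ hΔ => ?_
  rw [← (mem_CE.1 hΔ).1.1]
  exact Finset.card_biUnion_le_card_mul _ _ _ fun v _ => Finset.card_image_le

/-- Points on the ray from `y` in direction `i`. -/
def ray (y : V d) (i : Fin d) (k : ℕ) : V d := fun l => if l = i then y l + k else y l

lemma ray_zero (y : V d) (i : Fin d) : ray y i 0 = y := by
  funext l; simp [ray]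

lemma dist1_ray (y : V d) (i : Fin d) (k : ℕ) : dist1 (ray y i k) (ray y i (k+1)) = 1 := by
  unfold dist1
  rw [Finset.sum_eq_single i]
  · simp [ray]
  · intro j _ hj
    simp [ray, hj]
  · simp

lemma exit_ray (S : Finset (V d)) {y : V d} (hy : y ∈ S) (i : Fin d) :
    ∃ k : ℕ, (∀ j ≤ k, ray y i j ∈ S) ∧ ray y i (k+1) ∉ S := by
  classical
  have hex : ∃ k, ray y i k ∉ S := by
    by_contra hcon
    push Not at hcon
    have hinj : Function.Injective (ray y i) := by
      intro a b h
      have := congrFun h i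
      simpa [ray] using this
    exact Set.infinite_of_injective_forall_mem hinj hcon S.finite_toSet
  have h0 : Nat.find hex ≠ 0 := by
    intro h
    have := Nat.find_spec hex
    rw [h, ray_zero] at this
    exact this hy
  obtain ⟨k, hk⟩ := Nat.exists_eq_succ_of_ne_zero h0
  refine ⟨k, fun j hj => ?_, ?_⟩
  · have := Nat.find_min hex (m := j) (by omega)
    simpa using this
  · have := Nat.find_spec hex
    rwa [hk] at this

lemma exists_base (hd : 2 ≤ d) (S : Finset (V d)) {x : V d} (hx : x ∈ S) :
    ∃ k < (CE S).card, ray x ⟨0, by omega⟩ k ∈ inner S := by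
  obtain ⟨k, h1, h2⟩ := exit_ray S hx ⟨0, by omega⟩
  refine ⟨k, ?_, mem_inner.2 ⟨h1 k le_rfl, _, h2, near_of_dist1 (dist1_ray _ _ _)⟩⟩
  have hex : ∀ j, j ≤ k → ∃ Δ ∈ CE S, ∀ v ∈ Δ, v ⟨0, by omega⟩ = x ⟨0, by omega⟩ + j := by
    intro j hj
    obtain ⟨l, h3, h4⟩ := exit_ray S (h1 j hj) ⟨1, by omega⟩
    refine ⟨_, pair_mem_CE (h3 l le_rfl) h4 (dist1_ray _ _ _), ?_⟩
    intro v hv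
    simp only [Finset.mem_insert, Finset.mem_singleton] at hv
    rcases hv with rfl | rfl <;> simp [ray]
  choose! E hE1 hE2 using hex
  have : (Finset.range (k+1)).card ≤ (CE S).card := by
    refine Finset.card_le_card_of_injOn E (fun j hj => hE1 j ?_) ?_
    · simp at hj; omega
    · intro a ha b hb hab
      simp only [Finset.coe_range, Set.mem_Iio] at ha hb
      obtain ⟨v, hv, -⟩ := (mem_CE.1 (hE1 a (by omega))).2.1
      have e1 := hE2 a (by omega) v hv
      have e2 := hE2 b (by omega) v (hab ▸ hv)
      omega
  simp at this
  omega

/-! ### Counting -/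

lemma count_sets (hd : 2 ≤ d) (x p : V d) (n : ℕ) (F : Finset (Finset (V d)))
    (hF : ∀ S ∈ F, x ∈ S ∧ p ∉ S ∧ biconn S ∧ (CE S).card = n) :
    F.card ≤ n * (moves d).card ^ (4 * (moves d).card * n) := by
  classical
  have hex : ∀ S ∈ F, ∃ q : Fin n × (Fin (4 * (moves d).card * n) → ↥(moves d)),
      inner S = visited (ray x ⟨0, by omega⟩ q.1) (List.ofFn fun i => (q.2 i : V d)) := by
    intro S hS
    obtain ⟨h1, h2, h3, h4⟩ := hF S hS
    obtain ⟨k, hk, hk2⟩ := exists_base hd S h1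
    obtain ⟨w, a1, a2, a3⟩ := exists_walk (inner S) _ hk2
      (fun B hB hB1 hB2 => inner_connected h3 B hB hB1 hB2) _ (card_inner_le S)
    have hlen : w.length = 4 * (moves d).card * n := by rw [a1, h4]; ring
    refine ⟨(⟨k, h4 ▸ hk⟩, fun i => ⟨w.get (i.cast hlen.symm), a2 _ (List.get_mem _ _)⟩), ?_⟩
    simp only
    rw [← a3]
    congr 1
    apply List.ext_get
    · simp [hlen]
    · intro i _ _
      simp
  rcases F.eq_empty_or_nonempty with rfl | ⟨S0, hS0⟩
  · simp
  have : Nonempty (Fin n × (Fin (4 * (moves d).card * n) → ↥(moves d))) :=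
    ⟨(hex S0 hS0).choose⟩
  choose! g hg using hex
  have := Finset.card_le_card_of_injOn (s := F) (t := Finset.univ) g (fun _ _ => Finset.mem_coe.2 (Finset.mem_univ _)) (by
    intro S hS S' hS' h
    have e1 := hg S hS
    have e2 := hg S' hS'
    rw [h, ← e2] at e1
    exact inner_inj (hF S hS).2.2.1 (hF S' hS').2.2.1 p (hF S hS).2.1 (hF S' hS').2.1 e1)
  simpa using this

/-! ### Existence of the contour -/

lemma exists_contour (Λ : Finset (V d)) (hΛ : CConn Λ) (p : V d) (hp : p ∉ Λ) (ω : Config d)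
    (hω : plusOutside Λ ω) (x : V d) (hx : x ∈ Λ) (hωx : ω x = false) :
    ∃ S ⊆ Λ, x ∈ S ∧ biconn S ∧ ∀ y ∈ S, ∀ z, z ∉ S → near y z → ω y = false ∧ ω z = true := by
  classical
  let C : Set (V d) := {v | conn (minusSet ω) x v}
  let U : Set (V d) := {v | conn Cᶜ p v}
  have hxC : x ∈ C := Relation.ReflTransGen.refl
  have hCm : ∀ v ∈ C, ω v = false := by
    intro v hv
    have hv' : conn (minusSet ω) x v := hv
    induction hv' with
    | refl => exact hωx
    | tail _ h2 _ => exact h2.2.2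
  have hCΛ : ∀ v ∈ C, v ∈ Λ := by
    intro v hv
    by_contra h
    have := hω v h
    rw [hCm v hv] at this
    exact absurd this (by simp)
  have hUC : ∀ v ∈ U, v ∉ C := by
    intro v hv
    have hv' : conn Cᶜ p v := hv
    induction hv' with
    | refl => exact fun h => hp (hCΛ p h)
    | tail _ h2 _ => exact h2.2.2
  have hstep : ∀ u ∈ U, ∀ v, near u v → v ∉ C → v ∈ U := by
    intro u hu v h hv
    exact Relation.ReflTransGen.tail (show conn Cᶜ p u from hu) ⟨h, hUC u hu, hv⟩
  have hΛU : ∀ v, v ∉ Λ → v ∈ U := by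
    intro v hv
    have := conn_of_connInf hΛ.2 (x := p) (y := v) (by simpa using hp) (by simpa using hv)
    refine Relation.ReflTransGen.mono ?_ _ _ this
    rintro a b ⟨h1, h2, h3⟩
    exact ⟨h1, fun h => h2 (hCΛ a h), fun h => h3 (hCΛ b h)⟩
  let S : Finset (V d) := Λ.filter fun v => v ∉ U
  have hmS : ∀ v, v ∈ S ↔ v ∉ U := by
    intro v
    simp only [S, Finset.mem_filter, and_iff_right_iff_imp]
    intro h
    by_contra h'
    exact h (hΛU v h')
  have hCS : ∀ v ∈ C, v ∈ S := fun v hv => (hmS v).2 fun h => hUC v h hv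
  have hbd : ∀ y ∈ S, ∀ z, z ∉ S → near y z → y ∈ C := by
    intro y hy z hz h
    by_contra hyC
    have hzU : z ∈ U := by
      by_contra h'
      exact hz ((hmS z).2 h')
    exact (hmS y).1 hy (hstep z hzU y (near_symm h) hyC)
  have hCconn : ∀ v ∈ C, conn (↑S : Set (V d)) v x := by
    intro v hv
    have hv' : conn (minusSet ω) x v := hv
    induction hv' with
    | refl => exact Relation.ReflTransGen.refl
    | @tail b c h1 h2 ih =>
      exact Relation.ReflTransGen.head ⟨near_symm h2.1, hCS _ hv, hCS _ h1⟩ (ih h1)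
  have hSconn : ∀ v ∈ S, conn (↑S : Set (V d)) v x := by
    intro v hv
    have hvΛ : v ∈ Λ := (Finset.mem_filter.1 hv).1
    have hpath := conn_of_connInf hΛ.1 (x := v) (y := x) (by simpa using hvΛ) (by simpa using hx)
    revert hv
    refine Relation.ReflTransGen.head_induction_on hpath ?_ ?_
    · intro _; exact Relation.ReflTransGen.refl
    · intro a c h1 _ ih ha
      by_cases hc : c ∈ S
      · exact Relation.ReflTransGen.head ⟨h1.1, ha, hc⟩ (ih hc)
      · exact hCconn a (hbd a ha c hc h1.1)
  have hUconn : ∀ v ∈ U, conn ((↑S : Set (V d))ᶜ) p v := by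
    intro v hv
    have hv' : conn Cᶜ p v := hv
    induction hv' with
    | refl => exact Relation.ReflTransGen.refl
    | @tail b c h1 h2 ih =>
      refine Relation.ReflTransGen.tail (ih h1) ⟨h2.1, fun h => ?_, fun h => ?_⟩
      · exact (hmS b).1 h h1
      · exact (hmS c).1 h hv
  refine ⟨S, Finset.filter_subset _ _, hCS x hxC, ⟨?_, ?_⟩, ?_⟩
  · intro a ha b hb
    exact (hSconn a ha).trans (conn_symm (hSconn b hb))
  · intro a ha b hb
    have ha' : a ∈ U := by by_contra h; exact ha ((hmS a).2 h)
    have hb' : b ∈ U := by by_contra h; exact hb ((hmS b).2 h)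
    exact (conn_symm (hUconn a ha')).trans (hUconn b hb')
  · intro y hy z hz h
    have hyC := hbd y hy z hz h
    refine ⟨hCm y hyC, ?_⟩
    by_contra hzf
    have hzf : ω z = false := by simpa using hzf
    exact hz (hCS z (Relation.ReflTransGen.tail (show conn (minusSet ω) x y from hyC)
      ⟨h, hCm y hyC, hzf⟩))

/-! ### Energy estimates -/

lemma abs_le_supNorm {Ψ : Interaction d} (hloc : IsLocal Ψ) (Δ : Finset (V d)) (ω : Config d) :
    |Ψ Δ ω| ≤ supNorm Ψ Δ := by
  have hfin : (Set.range fun ω : Config d => |Ψ Δ ω|).Finite := by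
    refine (Set.finite_range fun f : ↥Δ → Bool => |Ψ Δ (fill Δ f plusC)|).subset ?_
    rintro _ ⟨ω, rfl⟩
    refine ⟨fun v => ω v, ?_⟩
    have : Ψ Δ (fill Δ (fun v => ω v) plusC) = Ψ Δ ω := by
      apply hloc
      intro v hv
      simp [fill, hv]
    simp only [this]
  exact le_ciSup hfin.bddAbove ω

lemma supNorm_nonneg (Ψ : Interaction d) (Δ : Finset (V d)) : 0 ≤ supNorm Ψ Δ :=
  Real.iSup_nonneg fun _ => abs_nonneg _

lemma supNorm_translate {Ψ : Interaction d} (ht : TransInv Ψ) (a : V d) (Δ : Finset (V d)) :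
    supNorm Ψ (Δ.image fun x => x - a) = supNorm Ψ Δ := by
  have hs : Function.Surjective (translate a : Config d → Config d) := by
    intro ω
    refine ⟨fun x => ω (x - a), ?_⟩
    funext x
    simp [translate]
  unfold supNorm
  rw [← hs.iSup_comp]
  simp only [ht a Δ]

/-- Summand of the norm based at `v`. -/
def pointTerm (Ψ : Interaction d) (v : V d) (Δ : Finset (V d)) : ℝ :=
  if v ∈ Δ then supNorm Ψ Δ else 0

lemma pointTerm_nonneg (Ψ : Interaction d) (v : V d) (Δ : Finset (V d)) :
    0 ≤ pointTerm Ψ v Δ := by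
  unfold pointTerm
  split_ifs
  · exact supNorm_nonneg _ _
  · exact le_rfl

lemma pointTerm_eq {Ψ : Interaction d} (ht : TransInv Ψ) (v : V d) :
    pointTerm Ψ v = normTerm Ψ ∘ (Equiv.subRight v).finsetCongr := by
  funext Δ
  have h1 : (Equiv.subRight v).finsetCongr Δ = Δ.image fun x => x - v := by
    simp [Equiv.finsetCongr_apply, Finset.map_eq_image]
    rfl
  simp only [pointTerm, normTerm, Function.comp, h1, supNorm_translate ht]
  have h2 : (0 : V d) ∈ Δ.image (fun x => x - v) ↔ v ∈ Δ := by
    simp [sub_eq_zero]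
  simp only [h2]

lemma pointTerm_hasSum {Ψ : Interaction d} (ht : TransInv Ψ) (hs : AbsSummable Ψ) (v : V d) :
    HasSum (pointTerm Ψ v) (anorm Ψ) := by
  rw [pointTerm_eq ht, Equiv.hasSum_iff]
  exact hs.hasSum

lemma summable_psi {Ψ : Interaction d} (hloc : IsLocal Ψ) (ht : TransInv Ψ) (hs : AbsSummable Ψ)
    (Λ : Finset (V d)) (ω : Config d) :
    Summable fun Δ : Finset (V d) => if (Δ ∩ Λ).Nonempty then Ψ Δ ω else 0 := by
  refine Summable.of_norm_bounded (g := fun Δ => ∑ v ∈ Λ, pointTerm Ψ v Δ)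
    (summable_sum fun v _ => (pointTerm_hasSum ht hs v).summable) ?_
  intro Δ
  split_ifs with h
  · obtain ⟨v, hv⟩ := h
    rw [Finset.mem_inter] at hv
    refine (abs_le_supNorm hloc Δ ω).trans ?_
    refine le_trans ?_ (Finset.single_le_sum (f := fun v => pointTerm Ψ v Δ)
      (fun v _ => pointTerm_nonneg Ψ v Δ) hv.2)
    simp [pointTerm, hv.1]
  · simp only [norm_zero]
    exact Finset.sum_nonneg fun v _ => pointTerm_nonneg Ψ v Δ

lemma summable_ising (β : ℝ) (Λ : Finset (V d)) (ω : Config d) :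
    Summable fun Δ : Finset (V d) => if (Δ ∩ Λ).Nonempty then ising β Δ ω else 0 := by
  classical
  refine summable_of_ne_finset_zero
    (s := (Λ ×ˢ moves d).image fun q => ({q.1, q.1 + q.2} : Finset (V d))) ?_
  intro Δ hΔ
  split_ifs with h
  · unfold ising
    split_ifs with hE
    · exfalso
      apply hΔ
      obtain ⟨y, hy⟩ := h
      rw [Finset.mem_inter] at hy
      obtain ⟨a, b, hab, rfl⟩ := Finset.card_eq_two.1 hE.1
      have hd := hE.2 a (by simp) b (by simp) hab
      have hn := near_of_dist1 hd
      have hy1 := hy.1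
      simp only [Finset.mem_insert, Finset.mem_singleton] at hy1
      rcases hy1 with rfl | rfl
      · refine Finset.mem_image.2 ⟨(y, b - y), Finset.mem_product.2 ⟨hy.2, ?_⟩, by simp⟩
        rw [mem_moves]; exact fun i => near_symm hn i
      · refine Finset.mem_image.2 ⟨(y, a - y), Finset.mem_product.2 ⟨hy.2, ?_⟩, ?_⟩
        · rw [mem_moves]; exact fun i => hn i
        · simp [Finset.pair_comm]
    · rfl
  · rfl

lemma ising_diff (β : ℝ) {S Λ : Finset (V d)} (hS : S ⊆ Λ) (ω : Config d)
    (hω : ∀ y ∈ S, ∀ z, z ∉ S → near y z → ω y = false ∧ ω z = true) (Δ : Finset (V d)) :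
    (if (Δ ∩ Λ).Nonempty then ising β Δ (flipOn S ω) else 0) =
      (if (Δ ∩ Λ).Nonempty then ising β Δ ω else 0) + (if Δ ∈ CE S then -2 * β else 0) := by
  by_cases hE : isEdge Δ
  · obtain ⟨a, b, hab, rfl⟩ := Finset.card_eq_two.1 hE.1
    have hd := hE.2 a (by simp) b (by simp) hab
    have hn := near_of_dist1 hd
    have hi : ∀ ξ : Config d, ising β {a, b} ξ = -β * (spin (ξ a) * spin (ξ b)) := by
      intro ξ
      unfold ising
      exact (if_pos hE).trans (by rw [Finset.prod_pair hab])
    have hm : ({a, b} : Finset (V d)) ∈ CE S ↔ ((a ∈ S ∧ b ∉ S) ∨ (b ∈ S ∧ a ∉ S)) := by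
      rw [mem_CE]
      simp only [hE, true_and, Finset.mem_insert, Finset.mem_singleton, exists_eq_or_imp,
        exists_eq_left]
      tauto
    simp only [hi, hm]
    by_cases ha : a ∈ S <;> by_cases hb : b ∈ S
    · simp only [flipOn, ha, hb]
      cases ω a <;> cases ω b <;> simp [spin]
    · have hne : (({a, b} : Finset (V d)) ∩ Λ).Nonempty := ⟨a, by simp [hS ha]⟩
      obtain ⟨h1, h2⟩ := hω a ha b hb hn
      simp only [hne, if_true, flipOn, ha, hb, h1, h2, spin]
      norm_num
      ring
    · have hne : (({a, b} : Finset (V d)) ∩ Λ).Nonempty := ⟨b, by simp [hS hb]⟩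
      obtain ⟨h1, h2⟩ := hω b hb a ha (near_symm hn)
      simp only [hne, if_true, flipOn, ha, hb, h1, h2, spin]
      norm_num
      ring
    · simp [flipOn, ha, hb]
  · have hC : Δ ∉ CE S := fun h => hE (mem_CE.1 h).1
    have hi : ∀ ξ : Config d, ising β Δ ξ = 0 := by
      intro ξ
      unfold ising
      exact if_neg hE
    simp [hC, hi]

open scoped Classical in
/-- A representative point of a finite set. -/
def rep (e : Finset (V d)) : V d := if h : e.Nonempty then h.choose else 0

lemma rep_mem {e : Finset (V d)} (h : e.Nonempty) : rep e ∈ e := by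
  unfold rep
  rw [dif_pos h]
  exact h.choose_spec

lemma exists_crossing {S Δ : Finset (V d)} (hΔ : Conn1 (↑Δ : Set (V d))) {a b : V d}
    (ha : a ∈ Δ) (haS : a ∈ S) (hb : b ∈ Δ) (hbS : b ∉ S) : ∃ e ∈ CE S, e ⊆ Δ := by
  obtain ⟨n, p, h0, hn, hA, hs⟩ := hΔ a ha b hb
  have : ∃ k < n, p k ∈ S ∧ p (k+1) ∉ S := by
    by_contra hcon
    push Not at hcon
    have : ∀ k ≤ n, p k ∈ S := by
      intro k
      induction k with
      | zero => intro _; rw [h0]; exact haS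
      | succ k ih => intro hk; exact hcon k (by omega) (ih (by omega))
    exact hbS (hn ▸ this n le_rfl)
  obtain ⟨k, hk, h1, h2⟩ := this
  refine ⟨_, pair_mem_CE h1 h2 (hs k hk), ?_⟩
  intro v hv
  simp only [Finset.mem_insert, Finset.mem_singleton] at hv
  rcases hv with rfl | rfl
  · exact hA k (by omega)
  · exact hA (k+1) (by omega)

lemma psi_diff {Ψ : Interaction d} (hloc : IsLocal Ψ) (hflip : SpinFlipSymm Ψ)
    (hz : ZeroOnNonConn Ψ) (S Λ : Finset (V d)) (ω : Config d) (Δ : Finset (V d)) :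
    (if (Δ ∩ Λ).Nonempty then Ψ Δ (flipOn S ω) else 0) ≤
      (if (Δ ∩ Λ).Nonempty then Ψ Δ ω else 0) + ∑ e ∈ CE S, 2 * pointTerm Ψ (rep e) Δ := by
  have hpos : 0 ≤ ∑ e ∈ CE S, 2 * pointTerm Ψ (rep e) Δ :=
    Finset.sum_nonneg fun e _ => mul_nonneg zero_le_two (pointTerm_nonneg Ψ _ Δ)
  by_cases hm : (Δ ∩ Λ).Nonempty
  · simp only [hm, if_true]
    by_cases hc : Conn1 (↑Δ : Set (V d))
    · by_cases h1 : ∃ a ∈ Δ, a ∈ S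
      · by_cases h2 : ∃ b ∈ Δ, b ∉ S
        · obtain ⟨a, ha, haS⟩ := h1
          obtain ⟨b, hb, hbS⟩ := h2
          obtain ⟨e, he, heΔ⟩ := exists_crossing hc ha haS hb hbS
          have hr : rep e ∈ Δ := by
            obtain ⟨y, hy, -⟩ := (mem_CE.1 he).2.1
            exact heΔ (rep_mem ⟨y, hy⟩)
          have := Finset.single_le_sum (f := fun e => 2 * pointTerm Ψ (rep e) Δ)
            (fun e _ => mul_nonneg zero_le_two (pointTerm_nonneg Ψ _ Δ)) he
          simp only [pointTerm, hr, if_true] at this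
          have b1 := (abs_le.1 (abs_le_supNorm hloc Δ ω)).1
          have b2 := (abs_le.1 (abs_le_supNorm hloc Δ (flipOn S ω))).2
          simp only [pointTerm]
          linarith
        · push Not at h2
          have : Ψ Δ (flipOn S ω) = Ψ Δ ω := by
            rw [← hflip Δ ω]
            apply hloc
            intro v hv
            simp [flipOn, h2 v hv]
          linarith
      · push Not at h1
        have : Ψ Δ (flipOn S ω) = Ψ Δ ω := by
          apply hloc
          intro v hv
          simp [flipOn, h1 v hv]
        linarith
    · rw [hz Δ hc, hz Δ hc]
      linarith
  · simpa [hm] using hpos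

lemma ham_split {Ψ : Interaction d} (β : ℝ) (Λ : Finset (V d)) (ω : Config d) :
    ham (Iadd (ising β) Ψ) Λ ω = ∑' Δ : Finset (V d),
      ((if (Δ ∩ Λ).Nonempty then ising β Δ ω else 0) +
        (if (Δ ∩ Λ).Nonempty then Ψ Δ ω else 0)) := by
  unfold ham Iadd
  refine tsum_congr fun Δ => ?_
  split_ifs <;> simp

lemma energy {Ψ : Interaction d} (hloc : IsLocal Ψ) (ht : TransInv Ψ) (hflip : SpinFlipSymm Ψ)
    (hz : ZeroOnNonConn Ψ) (hs : AbsSummable Ψ) (β : ℝ) {S Λ : Finset (V d)} (hS : S ⊆ Λ)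
    (ω : Config d) (hω : ∀ y ∈ S, ∀ z, z ∉ S → near y z → ω y = false ∧ ω z = true) :
    ham (Iadd (ising β) Ψ) Λ (flipOn S ω) ≤
      ham (Iadd (ising β) Ψ) Λ ω - 2 * (β - anorm Ψ) * (CE S).card := by
  have h1 : HasSum (fun Δ : Finset (V d) => if Δ ∈ CE S then -2 * β else 0)
      ((CE S).card * (-2 * β)) := by
    have := hasSum_sum_of_ne_finset_zero (L := SummationFilter.unconditional _) (f := fun Δ : Finset (V d) => if Δ ∈ CE S then -2 * β else 0)
      (s := CE S) (fun b hb => by simp [hb])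
    rwa [Finset.sum_congr rfl (fun e he => if_pos he), Finset.sum_const, nsmul_eq_mul] at this
  have h2 : HasSum (fun Δ : Finset (V d) => ∑ e ∈ CE S, 2 * pointTerm Ψ (rep e) Δ)
      ((CE S).card * (2 * anorm Ψ)) := by
    have := hasSum_sum (s := CE S) (f := fun e Δ => 2 * pointTerm Ψ (rep e) Δ)
      (a := fun _ => 2 * anorm Ψ) (fun e _ => (pointTerm_hasSum ht hs (rep e)).mul_left 2)
    rwa [Finset.sum_const, nsmul_eq_mul] at this
  have s1 := summable_ising β Λ ω
  have s2 := summable_psi hloc ht hs Λ ω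
  have s1' := summable_ising β Λ (flipOn S ω)
  have s2' := summable_psi hloc ht hs Λ (flipOn S ω)
  have h3 := ((s1.add s2).hasSum.add h1).add h2
  have h4 := (s1'.add s2').hasSum
  have := hasSum_le (fun Δ => ?_) h4 h3
  · rw [ham_split, ham_split]
    linarith
  · have := ising_diff β hS ω hω Δ
    have := psi_diff hloc hflip hz S Λ ω Δ
    linarith

lemma ham_flip {Ψ : Interaction d} (hflip : SpinFlipSymm Ψ) (β : ℝ) (Λ : Finset (V d))
    (ω : Config d) :
    ham (Iadd (ising β) Ψ) Λ (fun x => !(ω x)) = ham (Iadd (ising β) Ψ) Λ ω := by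
  unfold ham Iadd
  refine tsum_congr fun Δ => ?_
  have : ising β Δ (fun x => !(ω x)) = ising β Δ ω := by
    unfold ising
    split_ifs with h
    · have hsp : ∀ b, spin (!b) = -spin b := by intro b; cases b <;> simp [spin]
      simp only [hsp, Finset.prod_neg, h.1]
      norm_num
    · rfl
  rw [this, hflip]

/-! ### The Peierls sum -/

/-- Flip on `S`, for configurations on `Λ`. -/
def flipF (Λ S : Finset (V d)) (f : ↥Λ → Bool) : ↥Λ → Bool :=
  fun v => if (v : V d) ∈ S then !(f v) else f v

lemma flipF_invol (Λ S : Finset (V d)) : Function.Involutive (flipF Λ S) := by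
  intro f
  funext v
  by_cases h : (v : V d) ∈ S <;> simp [flipF, h]

lemma fill_flipF {Λ S : Finset (V d)} (hS : S ⊆ Λ) (f : ↥Λ → Bool) (η : Config d) :
    fill Λ (flipF Λ S f) η = flipOn S (fill Λ f η) := by
  funext v
  by_cases h : v ∈ Λ
  · simp [fill, flipF, flipOn, h]
  · have : v ∉ S := fun h' => h (hS h')
    simp [fill, flipOn, h, this]

lemma gibbsZ_pos (Φ : Interaction d) (Λ : Finset (V d)) (η : Config d) : 0 < gibbsZ Φ Λ η :=
  Finset.sum_pos (fun _ _ => Real.exp_pos _) Finset.univ_nonempty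

lemma geom_bound (r : ℝ) (hr0 : 0 ≤ r) (hr1 : r < 1) (N : Finset ℕ) (hN : ∀ n ∈ N, 1 ≤ n) :
    ∑ n ∈ N, r ^ n ≤ r / (1 - r) := by
  have h1 : HasSum (fun n : ℕ => r ^ (n + 1)) (r / (1 - r)) := by
    have := (hasSum_geometric_of_lt_one hr0 hr1).mul_left r
    simpa [pow_succ', div_eq_mul_inv] using this
  have h2 : ∑ n ∈ N, r ^ n = ∑ n ∈ N.image (fun n => n - 1), r ^ (n + 1) := by
    rw [Finset.sum_image]
    · refine Finset.sum_congr rfl fun n hn => ?_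
      rw [Nat.sub_add_cancel (hN n hn)]
    · intro a ha b hb hab
      have := hN a ha
      have := hN b hb
      simp only at hab
      omega
  rw [h2]
  exact sum_le_hasSum _ (fun n _ => pow_nonneg hr0 _) h1

/-- The entropy constant. -/
def entC (d : ℕ) : ℝ := 2 * ((moves d).card : ℝ) ^ (4 * (moves d).card)

lemma entC_ge (d : ℕ) : 1 ≤ entC d := by
  have h0 : (0 : V d) ∈ moves d := by rw [mem_moves]; simp
  have : 1 ≤ (moves d).card := Finset.card_pos.2 ⟨0, h0⟩
  have h1 : (1:ℝ) ≤ ((moves d).card : ℝ) := by exact_mod_cast this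
  have := one_le_pow₀ h1 (n := 4 * (moves d).card)
  unfold entC
  linarith

lemma peierls_sum (hd : 2 ≤ d) (x p : V d) (F : Finset (Finset (V d)))
    (hF : ∀ S ∈ F, x ∈ S ∧ p ∉ S ∧ biconn S) (t : ℝ) (ht0 : 0 ≤ t) (ht : entC d * t < 1) :
    ∑ S ∈ F, t ^ (CE S).card ≤ (entC d * t) / (1 - entC d * t) := by
  classical
  have hA : 0 ≤ entC d := by linarith [entC_ge d]
  rw [← Finset.sum_fiberwise_of_maps_to (s := F) (t := F.image fun S => (CE S).card)
    (g := fun S => (CE S).card) (fun S hS => Finset.mem_image_of_mem _ hS)]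
  refine le_trans (Finset.sum_le_sum (g := fun n => (entC d * t) ^ n) ?_)
    (geom_bound (entC d * t) (mul_nonneg hA ht0) ht _ ?_)
  · intro n _
    have hsum : ∑ S ∈ F with (CE S).card = n, t ^ (CE S).card =
        ((F.filter fun S => (CE S).card = n).card : ℝ) * t ^ n := by
      rw [← nsmul_eq_mul, ← Finset.sum_const]
      refine Finset.sum_congr rfl fun S hS => ?_
      rw [(Finset.mem_filter.1 hS).2]
    rw [hsum, mul_pow]
    refine mul_le_mul_of_nonneg_right ?_ (pow_nonneg ht0 n)
    have hc := count_sets hd x p n (F.filter fun S => (CE S).card = n) (by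
      intro S hS
      obtain ⟨h1, h2⟩ := Finset.mem_filter.1 hS
      obtain ⟨a, b, c⟩ := hF S h1
      exact ⟨a, b, c, h2⟩)
    have hc' : ((F.filter fun S => (CE S).card = n).card : ℝ) ≤
        n * ((moves d).card : ℝ) ^ (4 * (moves d).card * n) := by exact_mod_cast hc
    refine hc'.trans ?_
    unfold entC
    rw [mul_pow, ← pow_mul]
    refine mul_le_mul_of_nonneg_right ?_ (by positivity)
    exact_mod_cast (Nat.lt_two_pow_self (n := n)).le
  · intro n hn
    obtain ⟨S, hS, rfl⟩ := Finset.mem_image.1 hn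
    obtain ⟨k, hk, -⟩ := exists_base hd S (hF S hS).1
    show 1 ≤ (CE S).card
    omega

lemma exists_outside (hd : 2 ≤ d) (Λ : Finset (V d)) : ∃ p, p ∉ Λ := by
  have : Nonempty (Fin d) := ⟨⟨0, by omega⟩⟩
  have : Infinite (V d) := Pi.infinite_of_right
  exact Infinite.exists_notMem_finset Λ

open scoped Classical in
lemma minus_bound (hd : 2 ≤ d) {Ψ : Interaction d} (hloc : IsLocal Ψ) (ht : TransInv Ψ)
    (hflip : SpinFlipSymm Ψ) (hz : ZeroOnNonConn Ψ) (hs : AbsSummable Ψ) (β : ℝ)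
    (Λ : Finset (V d)) (hΛ : CConn Λ) (x : V d) (hx : x ∈ Λ)
    (hr : entC d * Real.exp (-(2 * (β - anorm Ψ))) < 1) :
    (∑ f : ↥Λ → Bool, if fill Λ f plusC x = false then
        Real.exp (-(ham (Iadd (ising β) Ψ) Λ (fill Λ f plusC))) else 0) ≤
      (entC d * Real.exp (-(2 * (β - anorm Ψ)))) /
        (1 - entC d * Real.exp (-(2 * (β - anorm Ψ)))) * gibbsZ (Iadd (ising β) Ψ) Λ plusC := by
  obtain ⟨p, hp⟩ := exists_outside hd Λ
  set t := Real.exp (-(2 * (β - anorm Ψ))) with ht_def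
  set W : (↥Λ → Bool) → ℝ :=
    fun f => Real.exp (-(ham (Iadd (ising β) Ψ) Λ (fill Λ f plusC))) with hW
  have hZ : gibbsZ (Iadd (ising β) Ψ) Λ plusC = ∑ f, W f := rfl
  let F : Finset (Finset (V d)) := Λ.powerset.filter fun S => x ∈ S ∧ biconn S
  let G : Finset (V d) → (↥Λ → Bool) → Prop := fun S f =>
    ∀ y ∈ S, ∀ z, z ∉ S → near y z → fill Λ f plusC y = false ∧ fill Λ f plusC z = true
  have hFp : ∀ S ∈ F, S ⊆ Λ ∧ x ∈ S ∧ biconn S := by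
    intro S hS
    obtain ⟨h1, h2⟩ := Finset.mem_filter.1 hS
    exact ⟨Finset.mem_powerset.1 h1, h2⟩
  have step1 : ∀ f, (if fill Λ f plusC x = false then W f else 0) ≤
      ∑ S ∈ F, if G S f then W f else 0 := by
    intro f
    have hnn : ∀ S ∈ F, 0 ≤ if G S f then W f else 0 := by
      intro S _
      split_ifs
      · exact (Real.exp_pos _).le
      · exact le_rfl
    split_ifs with hf
    · obtain ⟨S, h1, h2, h3, h4⟩ := exists_contour Λ hΛ p hp (fill Λ f plusC)
        (by intro v hv; simp [fill, hv, plusC]) x hx hf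
      have hSF : S ∈ F := Finset.mem_filter.2 ⟨Finset.mem_powerset.2 h1, h2, h3⟩
      refine le_trans ?_ (Finset.single_le_sum hnn hSF)
      rw [if_pos h4]
    · exact Finset.sum_nonneg hnn
  have step2 : ∀ S ∈ F, (∑ f, if G S f then W f else 0) ≤ t ^ (CE S).card * ∑ f, W f := by
    intro S hS
    have e : ∑ f, W f = ∑ f, W (flipF Λ S f) :=
      (Equiv.sum_comp (flipF_invol Λ S).toPerm W).symm
    rw [e, Finset.mul_sum]
    refine Finset.sum_le_sum fun f _ => ?_
    split_ifs with hG
    · have := energy hloc ht hflip hz hs β (hFp S hS).1 (fill Λ f plusC) hG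
      rw [← fill_flipF (hFp S hS).1] at this
      simp only [hW, ht_def]
      rw [← Real.exp_nat_mul, ← Real.exp_add]
      apply Real.exp_le_exp.2
      linarith
    · positivity
  calc _ ≤ ∑ f, ∑ S ∈ F, (if G S f then W f else 0) := Finset.sum_le_sum fun f _ => step1 f
    _ = ∑ S ∈ F, ∑ f, (if G S f then W f else 0) := Finset.sum_comm
    _ ≤ ∑ S ∈ F, t ^ (CE S).card * ∑ f, W f := Finset.sum_le_sum step2
    _ = (∑ S ∈ F, t ^ (CE S).card) * ∑ f, W f := by rw [Finset.sum_mul]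
    _ ≤ _ := by
      rw [hZ]
      refine mul_le_mul_of_nonneg_right ?_ (Finset.sum_nonneg fun f _ => (Real.exp_pos _).le)
      refine peierls_sum hd x p F (fun S hS => ?_) t (Real.exp_pos _).le hr
      obtain ⟨h1, h2, h3⟩ := hFp S hS
      exact ⟨h2, fun h => hp (h1 h), h3⟩

lemma minus_eq_plus {Ψ : Interaction d} (hflip : SpinFlipSymm Ψ) (β : ℝ) (Λ : Finset (V d))
    (x : V d) :
    bcProb (Iadd (ising β) Ψ) Λ minusC {ω | ω x = false} =
      bcProb (Iadd (ising β) Ψ) Λ plusC {ω | ω x = true} := by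
  have hinv : Function.Involutive (fun (f : ↥Λ → Bool) (v : ↥Λ) => !(f v)) := by
    intro f; funext v; simp
  have hfill : ∀ f : ↥Λ → Bool, fill Λ (fun v => !(f v)) plusC = fun y => !(fill Λ f minusC y) := by
    intro f
    funext v
    by_cases h : v ∈ Λ <;> simp [fill, h, plusC, minusC]
  unfold bcProb gibbsZ
  congr 1
  · refine Fintype.sum_equiv hinv.toPerm _ _ fun f => ?_
    simp only [Function.Involutive.coe_toPerm, hfill, ham_flip hflip, Set.mem_ofPred_eq]
    simp
  · refine Fintype.sum_equiv hinv.toPerm _ _ fun f => ?_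
    simp only [Function.Involutive.coe_toPerm, hfill, ham_flip hflip]

lemma plus_bound (hd : 2 ≤ d) {ε : ℝ} (hε0 : 0 < ε) (hε : ε < 1/2) {β δ : ℝ}
    (hL : Real.log (2 * entC d / ε) < β - δ) {Ψ : Interaction d} (hloc : IsLocal Ψ)
    (ht : TransInv Ψ)
    (hflip : SpinFlipSymm Ψ) (hz : ZeroOnNonConn Ψ) (hs : AbsSummable Ψ) (hδ : anorm Ψ < δ)
    (Λ : Finset (V d)) (hΛ : CConn Λ) (x : V d) (hx : x ∈ Λ) :
    1 - ε < bcProb (Iadd (ising β) Ψ) Λ plusC {ω | ω x = true} := by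
  classical
  have hA := entC_ge d
  have hlog : 0 < Real.log (2 * entC d / ε) := by
    apply Real.log_pos
    rw [lt_div_iff₀ hε0]
    linarith
  have hr : entC d * Real.exp (-(2 * (β - anorm Ψ))) ≤ ε / 2 := by
    have h1 : Real.exp (-(2 * (β - anorm Ψ))) ≤ Real.exp (-Real.log (2 * entC d / ε)) :=
      Real.exp_le_exp.2 (by linarith)
    rw [Real.exp_neg (Real.log _), Real.exp_log (by positivity)] at h1
    calc _ ≤ entC d * (2 * entC d / ε)⁻¹ := mul_le_mul_of_nonneg_left h1 (by linarith)
      _ = ε / 2 := by field_simp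
  have hm := minus_bound hd hloc ht hflip hz hs β Λ hΛ x hx (by linarith)
  set r := entC d * Real.exp (-(2 * (β - anorm Ψ)))
  have hZ := gibbsZ_pos (Iadd (ising β) Ψ) Λ plusC
  have hr2 : r / (1 - r) < ε := by
    rw [div_lt_iff₀ (by linarith)]
    nlinarith
  have hsplit : gibbsZ (Iadd (ising β) Ψ) Λ plusC =
      (∑ f : ↥Λ → Bool, if fill Λ f plusC ∈ {ω : Config d | ω x = true} then
        Real.exp (-(ham (Iadd (ising β) Ψ) Λ (fill Λ f plusC))) else 0) +
      (∑ f : ↥Λ → Bool, if fill Λ f plusC x = false then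
        Real.exp (-(ham (Iadd (ising β) Ψ) Λ (fill Λ f plusC))) else 0) := by
    rw [← Finset.sum_add_distrib]
    unfold gibbsZ
    refine Finset.sum_congr rfl fun f _ => ?_
    by_cases h : fill Λ f plusC x = true <;> simp [h]
  unfold bcProb
  rw [lt_div_iff₀ hZ]
  have := mul_lt_mul_of_pos_right hr2 hZ
  have e : ∀ a b c : ℝ, a = b + c → c < ε * a → (1 - ε) * a < b := by
    intro a b c h1 h2; linarith
  refine e _ _ _ ?_ (lt_of_le_of_lt hm this)
  convert hsplit

/-- For every `0 < ε < 1/2` there is `L > 0` such that for all `β, δ > 0`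
with `β - δ > L` and every translation invariant, spin-flip symmetric `Ψ` with `‖Ψ‖ < δ`
which is zero on non-`‖·‖₁`-connected sets, for every finite c-connected `Λ` and `x ∈ Λ`,
the finite Gibbs states with `±` boundary conditions are magnetized:
`μ⁺_{Φ,Λ}(ω(x) = 1) > 1 - ε` and `μ⁻_{Φ,Λ}(ω(x) = -1) > 1 - ε`. -/
theorem magnetization_plus_minus (d : ℕ) (hd : 2 ≤ d) (ε : ℝ) (hε0 : 0 < ε) (hε : ε < 1/2) :
    ∃ L > (0:ℝ), ∀ β δ : ℝ, 0 < β → 0 < δ → L < β - δ →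
      ∀ Ψ : Interaction d, IsLocal Ψ → TransInv Ψ → SpinFlipSymm Ψ → ZeroOnNonConn Ψ →
        AbsSummable Ψ → anorm Ψ < δ →
        ∀ Λ : Finset (V d), CConn Λ → ∀ x ∈ Λ,
          1 - ε < bcProb (Iadd (ising β) Ψ) Λ plusC {ω | ω x = true} ∧
          1 - ε < bcProb (Iadd (ising β) Ψ) Λ minusC {ω | ω x = false} := by
  refine ⟨Real.log (2 * entC d / ε), ?_, ?_⟩
  · apply Real.log_pos
    rw [lt_div_iff₀ hε0]
    linarith [entC_ge d]
  · intro β δ _ _ hL Ψ hloc ht hflip hz hs hδ Λ hΛ x hx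
    rw [minus_eq_plus hflip]
    have := plus_bound hd hε0 hε hL hloc ht hflip hz hs hδ Λ hΛ x hx
    exact ⟨this, this⟩

end
end Ising
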